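/- Let F be a Gap Algebra such that some operation of F is not {0,2}{1,2}-projective and such that F satisfies the Zhuk Condition, and let n ≥ 3. Then either every relation in Inv(F) of arity h < n + 1 is preserved by f^a_n, or every relation in Inv(F) of arity h < n + 1 is preserved by f^b_n. -/

import Mathlib

/-- The three-element domain. -/
abbrev D : Type := Fin 3

/-- A finitary operation on `D`, packaged with its arity. -/
abbrev Op : Type := Σ n : ℕ, (Fin n → D) → D

/-- The semilattice-without-unit operation `s`: `s(x,x) = x`, `s(x,y) = 2` for `x ≠ y`. -/
def sFun : (Fin 2 → D) → D := fun x => if x 0 = x 1 then x 0 else 2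

/-- `s` as a packaged operation. -/
def sOp : Op := ⟨2, sFun⟩

/-- The clone generated by a set `F` of operations on `D`: the smallest set of
operations containing `F` and all projections and closed under composition. -/
inductive InClone (F : Set Op) : Op → Prop
  | base {g : Op} : g ∈ F → InClone F g
  | proj {n : ℕ} (i : Fin n) : InClone F ⟨n, fun x => x i⟩
  | comp {n m : ℕ} (f : (Fin n → D) → D) (g : Fin n → (Fin m → D) → D) :
      InClone F ⟨n, f⟩ → (∀ i, InClone F ⟨m, g i⟩) →
      InClone F ⟨m, fun x => f (fun i => g i x)⟩

/-- Closure of a set `S ⊆ D^m` under coordinatewise applications of operations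
of the clone generated by `F`. -/
inductive InClosure (F : Set Op) {m : ℕ} (S : Set (Fin m → D)) : (Fin m → D) → Prop
  | base {t : Fin m → D} : t ∈ S → InClosure F S t
  | app {n : ℕ} (f : (Fin n → D) → D) (ts : Fin n → Fin m → D) :
      InClone F ⟨n, f⟩ → (∀ i, InClosure F S (ts i)) →
      InClosure F S (fun j => f (fun i => ts i j))

/-- `Λ_{m,k}`: the tuples of `D^m` in which at least `m - k` coordinates are equal. -/
def Lam (m k : ℕ) : Set (Fin m → D) :=
  {x | ∃ a : D, m - k ≤ Set.ncard {i : Fin m | x i = a}}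

/-- `F` is `k`-collapsible. -/
def KCollapsible (F : Set Op) (k : ℕ) : Prop :=
  ∀ m : ℕ, 1 ≤ m → ∀ t : Fin m → D, InClosure F (Lam m k) t

/-- `F` is collapsible: `k`-collapsible for some `k`. -/
def Collapsible (F : Set Op) : Prop := ∃ k, KCollapsible F k

/-- An operation is idempotent. -/
def Idem {n : ℕ} (g : (Fin n → D) → D) : Prop := ∀ x : D, g (fun _ => x) = x

/-- An operation preserves a subset `B ⊆ D`. -/
def PreservesSet {n : ℕ} (g : (Fin n → D) → D) (B : Set D) : Prop :=
  ∀ x : Fin n → D, (∀ i, x i ∈ B) → g x ∈ B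

/-- A tuple lies in `{0,1}^n`. -/
def Bool01 {n : ℕ} (x : Fin n → D) : Prop := ∀ j, x j = 0 ∨ x j = 1

/-- Property (*): for each coordinate `i` there is `x ∈ {0,1}^k` with
`f(x) ∈ {0,1}` and `f(x) ≠ x_i`. -/
def PropStar {k : ℕ} (f : (Fin k → D) → D) : Prop :=
  ∀ i : Fin k, ∃ x : Fin k → D, Bool01 x ∧ (f x = 0 ∨ f x = 1) ∧ f x ≠ x i

/-- Class (i): coordinates with a `0 ↦ 1` witness but no `1 ↦ 0` witness. -/
def ClassI {k : ℕ} (f : (Fin k → D) → D) : Set (Fin k) :=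
  {i | (∃ x, Bool01 x ∧ x i = 0 ∧ f x = 1) ∧ ¬ ∃ x, Bool01 x ∧ x i = 1 ∧ f x = 0}

/-- Class (ii): coordinates with a `1 ↦ 0` witness but no `0 ↦ 1` witness. -/
def ClassII {k : ℕ} (f : (Fin k → D) → D) : Set (Fin k) :=
  {i | (∃ x, Bool01 x ∧ x i = 1 ∧ f x = 0) ∧ ¬ ∃ x, Bool01 x ∧ x i = 0 ∧ f x = 1}

/-- An n-ary operation preserves an h-ary relation on `D`. -/
def OpPreservesRel {n h : ℕ} (g : (Fin n → D) → D) (ρ : Set (Fin h → D)) : Prop :=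
  ∀ t : Fin n → Fin h → D, (∀ i, t i ∈ ρ) → (fun j => g (fun i => t i j)) ∈ ρ

/-- `ρ ∈ Inv(F)`: the relation is preserved by every operation of `F`. -/
def InInv (F : Set Op) {h : ℕ} (ρ : Set (Fin h → D)) : Prop :=
  ∀ g ∈ F, OpPreservesRel g.2 ρ

/-- A Gap Algebra: a set of idempotent operations on `D` containing `s`,
all preserving `{0,2}` and `{1,2}`, that is not collapsible. -/
def GapAlgebra (F : Set Op) : Prop :=
  sOp ∈ F ∧
  (∀ g ∈ F, Idem g.2 ∧ PreservesSet g.2 {0, 2} ∧ PreservesSet g.2 {1, 2}) ∧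
  ¬ Collapsible F

/-- An operation is `{0,2}{1,2}`-projective. -/
def Proj0212 {n : ℕ} (g : (Fin n → D) → D) : Prop :=
  ∃ i : Fin n, ∀ x : Fin n → D,
    (x i ∈ ({0, 2} : Set D) → g x ∈ ({0, 2} : Set D)) ∧
    (x i ∈ ({1, 2} : Set D) → g x ∈ ({1, 2} : Set D))

/-- The Zhuk Condition for a set `F` of operations on `D`. -/
def ZhukCondition (F : Set Op) : Prop :=
  ∃ p : (Fin 2 → D) → D, ∃ r₃ : (Fin 3 → D) → D,
    InClone F ⟨2, p⟩ ∧ InClone F ⟨3, r₃⟩ ∧ Idem p ∧ Idem r₃ ∧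
    ((p ![0, 1] = 0 ∧ p ![0, 2] = 2 ∧
      r₃ ![0, 0, 1] = 0 ∧ r₃ ![0, 1, 0] = 0 ∧ r₃ ![0, 1, 1] = 2) ∨
     (p ![0, 1] = 1 ∧ p ![2, 1] = 2 ∧
      r₃ ![1, 0, 1] = 1 ∧ r₃ ![1, 1, 0] = 1 ∧ r₃ ![1, 0, 0] = 2))

/-- A finitary relation on `D`, packaged with its arity. -/
abbrev RelD : Type := Σ h : ℕ, Set (Fin h → D)

/-- `Pol(Δ)`: the operations preserving every relation of `Δ`. -/
def PolSet (Δ : Set RelD) : Set Op := {g | ∀ ρ ∈ Δ, OpPreservesRel g.2 ρ.2}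

-- The (n+1)-ary operation `f^a_n`: 0 on the all-0 tuple, 1 on the all-1 tuple,
-- 0 on 0-1 tuples with exactly one coordinate equal to 1, and 2 otherwise.
open Classical in
noncomputable def fa (n : ℕ) : (Fin (n + 1) → D) → D := fun t =>
  if ∀ i, t i = 0 then 0
  else if ∀ i, t i = 1 then 1
  else if Bool01 t ∧ Set.ncard {i | t i = 1} = 1 then 0
  else 2

-- The (n+1)-ary operation `f^b_n` (roles of 0 and 1 exchanged).
open Classical in
noncomputable def fb (n : ℕ) : (Fin (n + 1) → D) → D := fun t =>
  if ∀ i, t i = 1 then 1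
  else if ∀ i, t i = 0 then 0
  else if Bool01 t ∧ Set.ncard {i | t i = 0} = 1 then 1
  else 2

theorem sFun_pair (u v : D) : sFun ![u, v] = if u = v then u else 2 := rfl

theorem comp_pair {m : ℕ} (g : (Fin 2 → D) → D) (u v : Fin m → D) :
    (fun j => g (fun i => (![u, v] : Fin 2 → Fin m → D) i j)) = fun j => g ![u j, v j] := by
  funext j
  congr 1
  funext i
  fin_cases i <;> rfl

theorem comp_triple {m : ℕ} (g : (Fin 3 → D) → D) (u v w : Fin m → D) :
    (fun j => g (fun i => (![u, v, w] : Fin 3 → Fin m → D) i j)) =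
      fun j => g ![u j, v j, w j] := by
  funext j
  congr 1
  funext i
  fin_cases i <;> rfl

theorem OpPreservesRel.pair {h : ℕ} {g : (Fin 2 → D) → D} {ρ : Set (Fin h → D)}
    (hg : OpPreservesRel g ρ) {u v : Fin h → D} (hu : u ∈ ρ) (hv : v ∈ ρ) :
    (fun c => g ![u c, v c]) ∈ ρ := by
  rw [← comp_pair]
  exact hg _ fun i => by fin_cases i <;> assumption

theorem OpPreservesRel.triple {h : ℕ} {g : (Fin 3 → D) → D} {ρ : Set (Fin h → D)}
    (hg : OpPreservesRel g ρ) {u v w : Fin h → D} (hu : u ∈ ρ) (hv : v ∈ ρ) (hw : w ∈ ρ) :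
    (fun c => g ![u c, v c, w c]) ∈ ρ := by
  rw [← comp_triple]
  exact hg _ fun i => by fin_cases i <;> assumption

/-- Invariant relations are preserved by the whole generated clone. -/
theorem InInv.opPreservesRel {F : Set Op} {h : ℕ} {ρ : Set (Fin h → D)} (hρ : InInv F ρ)
    {g : Op} (hg : InClone F g) : OpPreservesRel g.2 ρ := by
  induction hg with
  | base hg => exact hρ _ hg
  | proj i => exact fun t ht => ht i
  | comp f g _ _ ihf ihg => exact fun t ht => ihf _ fun i => ihg i t ht

theorem InClosure.sFun_mem {F : Set Op} (hs : sOp ∈ F) {m : ℕ} {S : Set (Fin m → D)}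
    {u v : Fin m → D} (hu : InClosure F S u) (hv : InClosure F S v) :
    InClosure F S (fun j => if u j = v j then u j else 2) := by
  have := InClosure.app (F := F) (S := S) sFun ![u, v] (InClone.base hs)
    (fun i => by fin_cases i <;> assumption)
  rwa [comp_pair] at this

/-- Every tuple is the `s`-combination of two tuples over `{a, b}`. -/
theorem InClosure.of_two_valued {F : Set Op} (hs : sOp ∈ F) {a b : D} (hab : a ≠ b)
    {m : ℕ} {S : Set (Fin m → D)} {t u v : Fin m → D} (hu : InClosure F S u)
    (hv : InClosure F S v)
    (huv : ∀ j, (t j ≠ 2 ∧ u j = t j ∧ v j = t j) ∨ (t j = 2 ∧ u j = a ∧ v j = b) ∨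
      (t j = 2 ∧ u j = b ∧ v j = a)) : InClosure F S t := by
  convert InClosure.sFun_mem hs hu hv using 1
  funext j
  rcases huv j with ⟨_, h1, h2⟩ | ⟨h0, h1, h2⟩ | ⟨h0, h1, h2⟩
  · simp [h1, h2]
  · simp [h0, h1, h2, hab]
  · simp [h0, h1, h2, hab.symm]

theorem eq_or_eq_of_ne_two {a b x : D} (ha : a ≠ 2) (hb : b ≠ 2) (hab : a ≠ b) (hx : x ≠ 2) :
    x = a ∨ x = b := by
  revert a b x
  decide

/-- If no coordinate of `f` guards the value `b`, then `F` is collapsible. -/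
theorem collapsible_of_forall_exists {F : Set Op} (hs : sOp ∈ F) {a b : D} (ha : a ≠ 2)
    (hb : b ≠ 2) (hab : a ≠ b) {k : ℕ} {f : (Fin k → D) → D} (hf : InClone F ⟨k, f⟩)
    (hid : Idem f) (hw : ∀ i, ∃ x, x i ≠ b ∧ f x = b) : Collapsible F := by
  classical
  choose w hwi hwf using hw
  refine ⟨k * 2, fun m _ => ?_⟩
  have two_valued : ∀ N : ℕ, ∀ t : Fin m → D, (∀ j, t j = a ∨ t j = b) →
      (Finset.univ.filter fun j => t j = b).card = N → InClosure F (Lam m (k * 2)) t := by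
    intro N
    induction N using Nat.strong_induction_on with
    | _ N ih =>
    intro t ht hN
    by_cases hle : N ≤ k * 2
    · refine InClosure.base ⟨a, ?_⟩
      have hsplit := Finset.card_filter_add_card_filter_not (s := (Finset.univ : Finset (Fin m)))
        (fun j => t j = b)
      have hset : {j : Fin m | t j = a} =
          ↑(Finset.univ.filter fun j => ¬ t j = b) := by
        ext j
        rcases ht j with h | h <;> simp [h, hab, hab.symm]
      rw [hset, Set.ncard_coe_finset]
      simp only [Finset.card_univ, Fintype.card_fin] at hsplit
      omega
    · obtain ⟨e⟩ : Nonempty (Fin k × Fin 2 ↪ {j : Fin m // t j = b}) := by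
        apply Function.Embedding.nonempty_of_card_le
        rw [Fintype.card_subtype]
        simp only [Fintype.card_prod, Fintype.card_fin]
        omega
      -- the column of a position `e (i, β)` is `w i`; all other columns are constant
      let col : Fin m → Fin k → D := fun j l =>
        if h : ∃ q, (e q : Fin m) = j then w h.choose.1 l else t j
      let row : D → D → Fin k → Fin m → D := fun c d l j =>
        if col j l = 2 then
          if ∃ i, (e (i, 0) : Fin m) = j then c else d
        else col j l
      have col_e : ∀ q, col (e q) = w q.1 := by
        intro q
        have h : ∃ q', (e q' : Fin m) = e q := ⟨q, rfl⟩
        have : h.choose = q := e.injective (Subtype.ext h.choose_spec)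
        funext l
        simp only [col, dif_pos h, this]
      have col_ne : ∀ j l, t j = a → col j l = a := by
        intro j l hj
        have h : ¬ ∃ q, (e q : Fin m) = j := by
          rintro ⟨q, rfl⟩
          exact hab (hj.symm.trans (e q).2)
        simp only [col, dif_neg h, hj]
      have row_mem : ∀ c d l, (c = a ∨ c = b) → (d = a ∨ d = b) →
          (∃ q, row c d l (e q) = a) → InClosure F (Lam m (k * 2)) (row c d l) := by
        intro c d l hc hd ⟨q, hq⟩
        refine ih _ ?_ _ ?_ rfl
        · rw [← hN]
          refine Finset.card_lt_card (Finset.ssubset_iff_of_subset ?_ |>.2 ⟨e q, ?_, ?_⟩)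
          · intro j hj
            simp only [Finset.mem_filter, Finset.mem_univ, true_and] at hj ⊢
            refine (ht j).resolve_left fun h => hab ?_
            rw [← hj]
            simp only [row, col_ne j l h, if_neg ha]
          · simpa using (e q).2
          · simpa [hq] using hab
        · intro j
          simp only [row]
          split_ifs with h1 h2
          · exact hc
          · exact hd
          · exact eq_or_eq_of_ne_two ha hb hab h1
      have w_diag : ∀ i, w i i = a ∨ w i i = 2 := fun i => by
        by_cases h : w i i = 2
        · exact Or.inr h
        · exact Or.inl ((eq_or_eq_of_ne_two ha hb hab h).resolve_right (hwi i))
      have col_mem : ∀ l, InClosure F (Lam m (k * 2)) (fun j => col j l) := by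
        intro l
        refine InClosure.of_two_valued hs hab
          (row_mem a b l (.inl rfl) (.inr rfl) ⟨(l, 0), ?_⟩)
          (row_mem b a l (.inr rfl) (.inl rfl) ⟨(l, 1), ?_⟩) ?_
        · have h : ∃ i, (e (i, 0) : Fin m) = e (l, 0) := ⟨l, rfl⟩
          simp only [row, col_e, if_pos h]
          rcases w_diag l with h | h <;> simp [h]
        · have h : ¬ ∃ i, (e (i, 0) : Fin m) = e (l, 1) := by
            rintro ⟨i, hi⟩
            simpa using e.injective (Subtype.ext hi)
          simp only [row, col_e, if_neg h]
          rcases w_diag l with h | h <;> simp [h]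
        · intro j
          simp only [row]
          by_cases h1 : col j l = 2 <;> by_cases h2 : ∃ i, (e (i, 0) : Fin m) = j <;>
            simp [h1, h2]
      convert InClosure.app f (fun l j => col j l) hf col_mem using 1
      funext j
      by_cases h : ∃ q, (e q : Fin m) = j
      · obtain ⟨q, rfl⟩ := h
        exact (e q).2.trans ((congrArg f (col_e q)).trans (hwf q.1)).symm
      · have : (fun l => col j l) = fun _ => t j := by
          funext l
          simp only [col, dif_neg h]
        rw [this, hid]
  intro t
  refine InClosure.of_two_valued hs hab
    (two_valued _ (fun j => if t j = 2 then a else t j) (fun j => ?_) rfl)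
    (two_valued _ (fun j => if t j = 2 then b else t j) (fun j => ?_) rfl) fun j => ?_
  · by_cases h : t j = 2
    · simp [h]
    · simpa [h] using eq_or_eq_of_ne_two ha hb hab h
  · by_cases h : t j = 2
    · simp [h]
    · simpa [h] using eq_or_eq_of_ne_two ha hb hab h
  · by_cases h : t j = 2 <;> simp [h]

/-- A relation closed under `s` is closed under the `s`-combination of any family of its
members. -/
theorem combine_mem {h : ℕ} {ρ : Set (Fin h → D)} (hs : OpPreservesRel sFun ρ)
    {y₀ : Fin h → D} (hy₀ : y₀ ∈ ρ) {Y : Set (Fin h → D)} (hY : Y ⊆ ρ) :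
    ∃ z ∈ ρ, ∀ c, ((∀ y ∈ Y, y c = y₀ c) → z c = y₀ c) ∧ ((∃ y ∈ Y, y c ≠ y₀ c) → z c = 2) := by
  induction Y, Set.toFinite Y using Set.Finite.induction_on with
  | empty => exact ⟨y₀, hy₀, by simp⟩
  | @insert y Y _ _ ih =>
    obtain ⟨z, hz, hzc⟩ := ih ((Set.subset_insert y Y).trans hY)
    have hy : y ∈ ρ := hY (Set.mem_insert y Y)
    refine ⟨_, hs.pair hz (hs.pair hy₀ hy), fun c => ⟨fun hall => ?_, ?_⟩⟩
    · have h1 := (hzc c).1 fun y' hy' => hall y' (Set.mem_insert_of_mem y hy')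
      have h2 := hall y (Set.mem_insert y Y)
      simp [sFun_pair, h1, h2]
    · rintro ⟨y', hy', hne⟩
      rcases hy' with rfl | hy'
      · have : sFun ![y₀ c, y' c] = 2 := by rw [sFun_pair, if_neg (Ne.symm hne)]
        simp only [this]
        rw [sFun_pair]
        split_ifs with h
        · exact h
        · rfl
      · rw [sFun_pair, (hzc c).2 ⟨y', hy', hne⟩]
        split_ifs <;> rfl

/-- A tuple with value `b` at `i` and `a` elsewhere. -/
def IsUnitAt (a b : D) {n : ℕ} (i : Fin n) (t : Fin n → D) : Prop :=
  t i = b ∧ ∀ l, l ≠ i → t l = a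

/-- `g` is the `a`-biased operation: it is idempotent on `a` and `b`, sends tuples with a single
`b` among `a`s to `a`, and everything else to `2`. -/
def IsBiased (a b : D) {n : ℕ} (g : (Fin n → D) → D) : Prop :=
  ∀ t, (((∀ i, t i = a) ∨ ∃ i, IsUnitAt a b i t) ∧ g t = a) ∨ ((∀ i, t i = b) ∧ g t = b) ∨
    ((¬ ∀ i, t i = a) ∧ (¬ ∀ i, t i = b) ∧ (¬ ∃ i, IsUnitAt a b i t) ∧ g t = 2)

theorem isUnitAt_exists_iff {a b : D} (hab : a ≠ b) {n : ℕ} (t : Fin n → D) :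
    ((∀ j, t j = a ∨ t j = b) ∧ Set.ncard {i | t i = b} = 1) ↔ ∃ i, IsUnitAt a b i t := by
  rw [Set.ncard_eq_one]
  constructor
  · rintro ⟨hb, i, hi⟩
    refine ⟨i, by simpa using hi.ge rfl, fun l hl => (hb l).resolve_right fun h => hl ?_⟩
    simpa using hi.le h
  · rintro ⟨i, hi, hl⟩
    refine ⟨fun j => ?_, i, ?_⟩
    · by_cases h : j = i
      · exact Or.inr (h ▸ hi)
      · exact Or.inl (hl j h)
    · ext j
      by_cases h : j = i
      · simp [h, hi]
      · simp [h, hl j h, hab]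

theorem isBiased_fa {n : ℕ} : IsBiased 0 1 (fa n) := by
  intro t
  have h : Bool01 t ∧ Set.ncard {i | t i = 1} = 1 ↔ ∃ i, IsUnitAt 0 1 i t :=
    isUnitAt_exists_iff (by decide) t
  by_cases h0 : ∀ i, t i = 0
  · simp [fa, h0]
  by_cases h1 : ∀ i, t i = 1
  · exact .inr (.inl ⟨h1, by simp [fa, h1]⟩)
  by_cases hu : ∃ i, IsUnitAt 0 1 i t
  · exact .inl ⟨.inr hu, by rw [fa, if_neg h0, if_neg h1, if_pos (h.2 hu)]⟩
  · exact .inr (.inr ⟨h0, h1, hu, by rw [fa, if_neg h0, if_neg h1, if_neg (mt h.1 hu)]⟩)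

theorem isBiased_fb {n : ℕ} : IsBiased 1 0 (fb n) := by
  intro t
  have h := isUnitAt_exists_iff (a := 1) (b := 0) (by decide) t
  have hB : Bool01 t ↔ ∀ j, t j = 1 ∨ t j = 0 := forall_congr' fun j => or_comm
  rw [← hB] at h
  by_cases h0 : ∀ i, t i = 1
  · simp [fb, h0]
  by_cases h1 : ∀ i, t i = 0
  · exact .inr (.inl ⟨h1, by simp [fb, h1]⟩)
  by_cases hu : ∃ i, IsUnitAt 1 0 i t
  · exact .inl ⟨.inr hu, by rw [fb, if_neg h0, if_neg h1, if_pos (h.2 hu)]⟩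
  · exact .inr (.inr ⟨h0, h1, hu, by rw [fb, if_neg h0, if_neg h1, if_neg (mt h.1 hu)]⟩)

/-- A relation of arity less than `n` closed under suitable binary and ternary operations is
preserved by the biased operation of arity `n`. -/
theorem IsBiased.opPreservesRel {a b : D} (ha : a ≠ 2) (hb : b ≠ 2) (hab : a ≠ b) {n h : ℕ}
    (hn : h < n) {g : (Fin n → D) → D} (hg : IsBiased a b g) {ρ : Set (Fin h → D)}
    (hs : OpPreservesRel sFun ρ) {p q : D → D → D} {r : D → D → D → D}
    (hp : ∀ u ∈ ρ, ∀ v ∈ ρ, (fun c => p (u c) (v c)) ∈ ρ)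
    (hq : ∀ u ∈ ρ, ∀ v ∈ ρ, (fun c => q (u c) (v c)) ∈ ρ)
    (hr : ∀ u ∈ ρ, ∀ v ∈ ρ, ∀ w ∈ ρ, (fun c => r (u c) (v c) (w c)) ∈ ρ)
    (hpi : ∀ x, p x x = x) (hqi : ∀ x, q x x = x) (hri : ∀ x, r x x x = x)
    (hp1 : p a b = a) (hp2 : p a 2 = 2) (hq1 : q a b = a) (hq2 : ∀ x, x ≠ b → q b x ≠ b)
    (hr1 : r a a b = a) (hr2 : r a b a = a) (hr3 : r a b b = 2) : OpPreservesRel g ρ := by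
  intro t ht
  obtain ⟨j, hj⟩ : ∃ j, ∀ c, ¬ IsUnitAt a b j (fun i => t i c) := by
    by_contra! hcon
    choose c hc using hcon
    have hinj : Function.Injective c := by
      intro i i' hii
      by_contra hne
      have h1 := (hc i').2 i hne
      rw [← hii] at h1
      exact hab (h1.symm.trans (hc i).1)
    have := Fintype.card_le_of_injective c hinj
    simp only [Fintype.card_fin] at this
    omega
  let Y : Set (Fin h → D) :=
    {y | y ∈ ρ ∧ ∀ c, g (fun i => t i c) ≠ 2 → y c = g (fun i => t i c)}
  -- on columns where `g` is not `2`, the possible entries at `j` and elsewhere are restricted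
  have mem_Y : ∀ y ∈ ρ, (∀ c, (∀ i, t i c = a) → y c = a) → (∀ c, (∀ i, t i c = b) → y c = b) →
      (∀ c i, i ≠ j → IsUnitAt a b i (fun i => t i c) → y c = a) → y ∈ Y := by
    intro y hy h1 h2 h3
    refine ⟨hy, fun c hc => ?_⟩
    rcases hg fun i => t i c with ⟨hA | ⟨i, hi⟩, e⟩ | ⟨hB, e⟩ | ⟨_, _, _, e⟩
    · rw [e, h1 c hA]
    · rw [e, h3 c i (fun hij => hj c (hij ▸ hi)) hi]
    · rw [e, h2 c hB]
    · exact absurd e hc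
  have htY : t j ∈ Y := mem_Y _ (ht j) (fun c hc => hc j) (fun c hc => hc j)
    fun c i hi hu => hu.2 j hi.symm
  have pair_Y : ∀ f : D → D → D, (∀ u ∈ ρ, ∀ v ∈ ρ, (fun c => f (u c) (v c)) ∈ ρ) →
      (∀ x, f x x = x) → f a b = a → ∀ i, (fun c => f (t j c) (t i c)) ∈ Y := by
    intro f hf hfi hfab i
    refine mem_Y _ (hf _ (ht j) _ (ht i)) (fun c hc => by simp only [hc, hfi])
      (fun c hc => by simp only [hc, hfi]) fun c l hl hu => ?_
    have h1 : t j c = a := hu.2 j hl.symm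
    by_cases hil : i = l
    · have h2 : t i c = b := hil ▸ hu.1
      simp only [h1, h2, hfab]
    · have h2 : t i c = a := hu.2 i hil
      simp only [h1, h2, hfi]
  have triple_Y : ∀ i l, i ≠ l → (fun c => r (t j c) (t i c) (t l c)) ∈ Y := by
    intro i l hil
    refine mem_Y _ (hr _ (ht j) _ (ht i) _ (ht l)) (fun c hc => by simp only [hc, hri])
      (fun c hc => by simp only [hc, hri]) fun c k hk hu => ?_
    have h1 : t j c = a := hu.2 j hk.symm
    by_cases hik : i = k
    · have h2 : t i c = b := hik ▸ hu.1
      have h3 : t l c = a := hu.2 l fun h => hil (hik.trans h.symm)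
      simp only [h1, h2, h3, hr2]
    · have h2 : t i c = a := hu.2 i hik
      by_cases hlk : l = k
      · have h3 : t l c = b := hlk ▸ hu.1
        simp only [h1, h2, h3, hr1]
      · have h3 : t l c = a := hu.2 l hlk
        simp only [h1, h2, h3, hri]
  obtain ⟨z, hz, hzc⟩ := combine_mem hs (ht j) (fun y (hy : y ∈ Y) => hy.1)
  convert hz using 1
  funext c
  by_cases hc : g (fun i => t i c) = 2
  · rw [hc]
    by_cases hj2 : t j c = 2
    · by_cases hall : ∀ y ∈ Y, y c = t j c
      · rw [(hzc c).1 hall, hj2]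
      · push Not at hall
        exact ((hzc c).2 hall).symm
    refine ((hzc c).2 ?_).symm
    obtain ⟨hA, hB, hU⟩ : (¬ ∀ i, t i c = a) ∧ (¬ ∀ i, t i c = b) ∧
        ¬ ∃ i, IsUnitAt a b i fun i => t i c := by
      rcases hg fun i => t i c with ⟨_, e⟩ | ⟨_, e⟩ | ⟨hA, hB, hU, _⟩
      · exact absurd (e.symm.trans hc) ha
      · exact absurd (e.symm.trans hc) hb
      · exact ⟨hA, hB, hU⟩
    rcases eq_or_eq_of_ne_two ha hb hab hj2 with hja | hjb
    · by_cases h2 : ∃ i, t i c = 2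
      · obtain ⟨i, hi⟩ := h2
        refine ⟨_, pair_Y p hp hpi hp1 i, ?_⟩
        simp only [hja, hi, hp2]
        exact ha.symm
      · push Not at h2 hA
        obtain ⟨i, hi⟩ := hA
        have hib := (eq_or_eq_of_ne_two ha hb hab (h2 i)).resolve_left hi
        obtain ⟨l, hli, hl⟩ : ∃ l, l ≠ i ∧ t l c ≠ a := by
          by_contra! hcon
          exact hU ⟨i, hib, hcon⟩
        have hlb := (eq_or_eq_of_ne_two ha hb hab (h2 l)).resolve_left hl
        refine ⟨_, triple_Y i l hli.symm, ?_⟩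
        simp only [hja, hib, hlb, hr3]
        exact ha.symm
    · push Not at hB
      obtain ⟨i, hi⟩ := hB
      refine ⟨_, pair_Y q hq hqi hq1 i, ?_⟩
      simp only [hjb]
      exact hq2 _ hi
  · rw [(hzc c).1 fun y hy => (hy.2 c hc).trans (htY.2 c hc).symm, htY.2 c hc]

theorem guard_both {a b y z : D} (ha : a ≠ 2) (hb : b ≠ 2) (hab : a ≠ b) (h1 : y ≠ b → z ≠ b)
    (h2 : y ≠ a → z ≠ a) : (y = 0 ∨ y = 2 → z = 0 ∨ z = 2) ∧ (y = 1 ∨ y = 2 → z = 1 ∨ z = 2) := by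
  revert a b y z
  decide

/-- In a gap algebra with a non-projective operation there is a binary operation `q`
preserving all invariant relations, with `q a b = a` and never taking the value `b` at `(b, x)`
with `x ≠ b`. -/
theorem GapAlgebra.exists_binary {F : Set Op} (hgap : GapAlgebra F)
    (hproj : ∃ g ∈ F, ¬ Proj0212 g.2) {a b : D} (ha : a ≠ 2) (hb : b ≠ 2) (hab : a ≠ b) :
    ∃ q : D → D → D, (∀ x, q x x = x) ∧ q a b = a ∧ (∀ x, x ≠ b → q b x ≠ b) ∧
      ∀ (h : ℕ) (ρ : Set (Fin h → D)), InInv F ρ →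
        ∀ u ∈ ρ, ∀ v ∈ ρ, (fun c => q (u c) (v c)) ∈ ρ := by
  obtain ⟨⟨k, f⟩, hfF, hf⟩ := hproj
  obtain ⟨hs, hF, hcol⟩ := hgap
  have hid : Idem f := (hF _ hfF).1
  obtain ⟨i, hi⟩ : ∃ i, ∀ x, x i ≠ b → f x ≠ b := by
    by_contra! hcon
    exact hcol (collapsible_of_forall_exists hs ha hb hab (InClone.base hfF) hid hcon)
  obtain ⟨x, hxi, hx⟩ : ∃ x, x i ≠ a ∧ f x = a := by
    by_contra! hcon
    refine hf ⟨i, fun x => ?_⟩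
    simp only [Set.mem_insert_iff, Set.mem_singleton_iff]
    exact guard_both ha hb hab (hi x) (hcon x)
  let m : D → D → Fin k → D := fun u v l =>
    if x l = a then u else if x l = b then v else sFun ![u, v]
  refine ⟨fun u v => f (m u v), fun y => ?_, ?_, fun y hy => hi _ ?_, ?_⟩
  · have : m y y = fun _ => y := by
      funext l
      simp [m, sFun_pair]
    simp only [this, hid y]
  · have : m a b = x := by
      funext l
      simp only [m, sFun_pair, if_neg hab]
      by_cases h1 : x l = a
      · rw [if_pos h1, h1]
      · by_cases h2 : x l = b
        · rw [if_neg h1, if_pos h2, h2]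
        · rw [if_neg h1, if_neg h2]
          by_contra h3
          exact (eq_or_eq_of_ne_two ha hb hab (Ne.symm h3)).elim h1 h2
    simp only [this, hx]
  · simp only [m, if_neg hxi, sFun_pair, if_neg (Ne.symm hy)]
    split_ifs
    · exact hy
    · exact hb.symm
  · intro h ρ hρ u hu v hv
    refine hρ _ hfF (fun l c => m (u c) (v c) l) fun l => ?_
    simp only [m]
    split_ifs
    · exact hu
    · exact hv
    · exact OpPreservesRel.pair (hρ _ hs) hu hv

theorem idem_pair {g : (Fin 2 → D) → D} (hg : Idem g) (x : D) : g ![x, x] = x := by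
  convert hg x using 2
  funext i
  fin_cases i <;> rfl

theorem idem_triple {g : (Fin 3 → D) → D} (hg : Idem g) (x : D) : g ![x, x, x] = x := by
  convert hg x using 2
  funext i
  fin_cases i <;> rfl

theorem statement12 (F : Set Op) (hgap : GapAlgebra F)
    (hproj : ∃ g ∈ F, ¬ Proj0212 g.2)
    (hzhuk : ZhukCondition F) (n : ℕ) (hn : 3 ≤ n) :
    (∀ h : ℕ, h < n + 1 → ∀ ρ : Set (Fin h → D), InInv F ρ → OpPreservesRel (fa n) ρ) ∨
    (∀ h : ℕ, h < n + 1 → ∀ ρ : Set (Fin h → D), InInv F ρ → OpPreservesRel (fb n) ρ) := by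
  obtain ⟨p, r, hp, hr, hpi, hri, ⟨h1, h2, h3, h4, h5⟩ | ⟨h1, h2, h3, h4, h5⟩⟩ := hzhuk
  · obtain ⟨q, hqi, hq1, hq2, hq⟩ :=
      hgap.exists_binary hproj (a := 0) (b := 1) (by decide) (by decide) (by decide)
    refine .inl fun h hh ρ hρ => isBiased_fa.opPreservesRel (p := fun x y => p ![x, y]) (q := q)
      (r := fun x y z => r ![x, y, z]) (by decide) (by decide) (by decide) hh (hρ _ hgap.1)
      (fun u hu v hv => (hρ.opPreservesRel hp).pair hu hv) (hq h ρ hρ)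
      (fun u hu v hv w hw => (hρ.opPreservesRel hr).triple hu hv hw)
      (idem_pair hpi) hqi (idem_triple hri) h1 h2 hq1 hq2 h3 h4 h5
  · obtain ⟨q, hqi, hq1, hq2, hq⟩ :=
      hgap.exists_binary hproj (a := 1) (b := 0) (by decide) (by decide) (by decide)
    refine .inr fun h hh ρ hρ => isBiased_fb.opPreservesRel (p := fun x y => p ![y, x]) (q := q)
      (r := fun x y z => r ![x, y, z]) (by decide) (by decide) (by decide) hh (hρ _ hgap.1)
      (fun u hu v hv => (hρ.opPreservesRel hp).pair hv hu) (hq h ρ hρ)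
      (fun u hu v hv w hw => (hρ.opPreservesRel hr).triple hu hv hw)
      (idem_pair hpi) hqi (idem_triple hri) h1 h2 hq1 hq2 h4 h3 h5
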